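/- Suppose R is not simply laced. Let (c_λ)_{λ∈Q} be an admissible family with values in F = ℚ(q,t), and set X = (1 − t^{−1})/(1 − q·t^{ht(θ)}). Then for every long root λ one has c_λ = t^{ht(λ)+D_λ(ℓ)}·X + (t^{ht(λ)} − t^{ht(λ)+D_λ(ℓ)}). -/

import Mathlib

open scoped RealInnerProductSpace

attribute [local instance] Classical.propDecidable

noncomputable section

/-- The reflection in the hyperplane orthogonal to `α`. -/
def sref {V : Type*} [NormedAddCommGroup V] [InnerProductSpace ℝ V] (α x : V) : V :=
  x - (2 * ⟪x, α⟫ / ⟪α, α⟫) • α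

/-- The coroot `α^∨ = 2α/(α,α)`. -/
def coroot {V : Type*} [NormedAddCommGroup V] [InnerProductSpace ℝ V] (α : V) : V :=
  (2 / ⟪α, α⟫) • α

/-- The data of a finite reduced irreducible crystallographic root system `R` in a real
inner product space, together with a fixed choice of positive roots and simple roots. -/
structure RSD (V : Type*) [NormedAddCommGroup V] [InnerProductSpace ℝ V] where
  R : Finset V
  Rpos : Finset V
  n : ℕ
  npos : 0 < n
  simple : Fin n → V
  simple_mem : ∀ i, simple i ∈ Rpos
  pos_sub : Rpos ⊆ R
  root_ne_zero : ∀ α ∈ R, α ≠ 0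
  pos_or_neg : ∀ α ∈ R, α ∈ Rpos ∨ -α ∈ Rpos
  not_both : ∀ α ∈ Rpos, -α ∉ Rpos
  pos_combo : ∀ α ∈ Rpos, ∃ c : Fin n → ℕ, α = ∑ i, (c i : ℝ) • simple i
  simple_indep : LinearIndependent ℝ simple
  reduced : ∀ α ∈ R, ∀ c : ℝ, c • α ∈ R → c = 1 ∨ c = -1
  crystal : ∀ α ∈ R, ∀ β ∈ R, ∃ k : ℤ, ⟪β, coroot α⟫ = (k : ℝ)
  refl_mem : ∀ α ∈ R, ∀ β ∈ R, sref α β ∈ R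
  spanning : Submodule.span ℝ (R : Set V) = ⊤
  irred : ∀ s : Set V, (∀ α ∈ R, ∀ β ∈ R, α ∈ s → β ∉ s → ⟪α, β⟫ = 0) →
    (∀ α ∈ R, α ∈ s) ∨ (∀ α ∈ R, α ∉ s)

namespace RSD

variable {V : Type*} [NormedAddCommGroup V] [InnerProductSpace ℝ V]

/-- The map of `V` determined by a word in the simple reflections. -/
def wordMap (S : RSD V) (l : List (Fin S.n)) : V → V :=
  l.foldr (fun i f => sref (S.simple i) ∘ f) id

/-- `w : V → V` is an element of the Weyl group `W`, i.e. a product of simple reflections. -/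
def IsWeyl (S : RSD V) (w : V → V) : Prop := ∃ l : List (Fin S.n), w = S.wordMap l

/-- The length `ℓ(w)` of a Weyl group element: the smallest length of a word in the simple
reflections representing `w`. -/
def len (S : RSD V) (w : V → V) : ℕ :=
  sInf {k | ∃ l : List (Fin S.n), l.length = k ∧ w = S.wordMap l}

/-- `x` and `y` lie in the same Weyl group orbit. -/
def sameOrbit (S : RSD V) (x y : V) : Prop := ∃ w, S.IsWeyl w ∧ w x = y

/-- `x` is dominant: `(x, α_i) ≥ 0` for all simple roots. -/
def Dominant (S : RSD V) (x : V) : Prop := ∀ i, 0 ≤ ⟪x, S.simple i⟫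

/-- `w` is a Weyl group element of minimal length among those sending `x` to `y`. -/
def IsMinWord (S : RSD V) (x y : V) (w : V → V) : Prop :=
  S.IsWeyl w ∧ w x = y ∧ ∀ w' : V → V, S.IsWeyl w' → w' x = y → S.len w ≤ S.len w'

/-- Membership in the root lattice `Q`, the ℤ-span of the simple roots. -/
def inQ (S : RSD V) (x : V) : Prop :=
  ∃ c : Fin S.n → ℤ, x = ∑ i, (c i : ℝ) • S.simple i

/-- The height `ht(λ) = Σ a_i` of an element `λ = Σ a_i α_i` of the root lattice
(the coefficients are unique since the simple roots are linearly independent). -/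
def htZ (S : RSD V) (x : V) : ℤ :=
  if h : ∃ c : Fin S.n → ℤ, x = ∑ i, (c i : ℝ) • S.simple i then ∑ i, h.choose i else 0

/-- The inversion set `Π(w) = {α ∈ R⁺ : w(α) ∈ R⁻}`. -/
def PiSet (S : RSD V) (w : V → V) : Finset V :=
  S.Rpos.filter (fun α => -(w α) ∈ S.Rpos)

/-- `α` is a short root (if all roots have the same length, all roots are short). -/
def IsShort (S : RSD V) (α : V) : Prop :=
  α ∈ S.R ∧ ∀ β ∈ S.R, ⟪α, α⟫ ≤ ⟪β, β⟫

/-- `α` is a long root. -/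
def IsLong (S : RSD V) (α : V) : Prop :=
  α ∈ S.R ∧ ∀ β ∈ S.R, ⟪β, β⟫ ≤ ⟪α, α⟫

/-- The short roots in the inversion set `Π(w)`. -/
def PiS (S : RSD V) (w : V → V) : Finset V :=
  (S.PiSet w).filter (fun α => S.IsShort α)

/-- The long roots in the inversion set `Π(w)`. -/
def PiL (S : RSD V) (w : V → V) : Finset V :=
  (S.PiSet w).filter (fun α => S.IsLong α)

end RSD


/-- The field `F = ℚ(q,t)` of rational functions in two variables over `ℚ`. -/
abbrev FF : Type := FractionRing (MvPolynomial (Fin 2) ℚ)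

/-- The variable `q` of `ℚ(q,t)`. -/
def qq : FF := algebraMap (MvPolynomial (Fin 2) ℚ) FF (MvPolynomial.X 0)

/-- The variable `t` of `ℚ(q,t)`. -/
def tt : FF := algebraMap (MvPolynomial (Fin 2) ℚ) FF (MvPolynomial.X 1)

/-- A family `(c_λ)_{λ∈Q}` of elements of `F = ℚ(q,t)` is admissible if `c_0 = 1` and it
satisfies Cherednik's relations: (i) for every `λ ∈ Q` and simple root `α_i` with
`k = (λ, α_i^∨) > 0`, `t·c_{s_i(λ)} − c_λ = (1−t)·(c_{λ−α_i} + ⋯ + c_{λ−(k−1)α_i})`;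
(ii) for every `λ ∈ Q` with `k = (λ, θ^∨) > 0` (`θ` the highest root),
`t·q^k·c_λ − c_{s_θ(λ)} = (1−t)·(q^{k−1}c_{λ−θ} + ⋯ + q·c_{λ−(k−1)θ})`. -/
def Admissible {V : Type*} [NormedAddCommGroup V] [InnerProductSpace ℝ V]
    (S : RSD V) (θ : V) (c : V → FF) : Prop :=
  c 0 = 1 ∧
  (∀ lam : V, S.inQ lam → ∀ i : Fin S.n, ∀ k : ℕ, 0 < k →
      ⟪lam, coroot (S.simple i)⟫ = (k : ℝ) →
      tt * c (sref (S.simple i) lam) - c lam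
        = (1 - tt) * ∑ j ∈ Finset.Ico 1 k, c (lam - (j : ℝ) • S.simple i)) ∧
  (∀ lam : V, S.inQ lam → ∀ k : ℕ, 0 < k → ⟪lam, coroot θ⟫ = (k : ℝ) →
      tt * qq ^ k * c lam - c (sref θ lam)
        = (1 - tt) * ∑ j ∈ Finset.Ico 1 k, qq ^ (k - j) * c (lam - (j : ℝ) • θ))

section Reflection

variable {V : Type*} [NormedAddCommGroup V] [InnerProductSpace ℝ V]

theorem inner_coroot (x α : V) : ⟪x, coroot α⟫ = 2 * ⟪x, α⟫ / ⟪α, α⟫ := by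
  rw [coroot, inner_smul_right]; ring

theorem sref_self {α : V} (h : α ≠ 0) : sref α α = -α := by
  have : ⟪α, α⟫ ≠ 0 := inner_self_ne_zero.2 h
  rw [sref, mul_div_assoc, div_self this, mul_one, two_smul]
  abel

theorem sref_of_inner_eq_zero {α x : V} (h : ⟪x, α⟫ = 0) : sref α x = x := by
  simp [sref, h]

theorem sref_neg (α x : V) : sref α (-x) = -sref α x := by
  simp only [sref, inner_neg_left, mul_neg, neg_div, neg_smul]
  abel

theorem inner_sref (α x y : V) : ⟪sref α x, sref α y⟫ = ⟪x, y⟫ := by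
  rcases eq_or_ne α 0 with rfl | h
  · simp [sref]
  have h' : ⟪α, α⟫ ≠ 0 := inner_self_ne_zero.2 h
  simp only [sref, inner_sub_left, inner_sub_right, real_inner_smul_left,
    real_inner_smul_right, real_inner_comm α y]
  field_simp
  ring

theorem inner_sref_left {α : V} (x : V) : ⟪sref α x, α⟫ = -⟪x, α⟫ := by
  rcases eq_or_ne α 0 with rfl | h
  · simp
  have h' : ⟪α, α⟫ ≠ 0 := inner_self_ne_zero.2 h
  simp only [sref, inner_sub_left, real_inner_smul_left]
  field_simp
  ring

theorem sref_sref (α x : V) : sref α (sref α x) = x := by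
  conv_lhs => rw [sref, inner_sref_left, sref]
  rw [mul_neg, neg_div, neg_smul]
  abel

end Reflection

namespace RSD

variable {V : Type*} [NormedAddCommGroup V] [InnerProductSpace ℝ V] (S : RSD V)

theorem inner_self_pos {α : V} (hα : α ∈ S.R) : 0 < ⟪α, α⟫ :=
  real_inner_self_pos.2 (S.root_ne_zero α hα)

theorem neg_mem {α : V} (hα : α ∈ S.R) : -α ∈ S.R := by
  simpa [sref_self (S.root_ne_zero α hα)] using S.refl_mem α hα α hα

theorem simple_mem_R (i : Fin S.n) : S.simple i ∈ S.R := S.pos_sub (S.simple_mem i)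

theorem span_simple : ⊤ ≤ Submodule.span ℝ (Set.range S.simple) := by
  rw [← S.spanning, Submodule.span_le]
  have key : ∀ α ∈ S.Rpos, α ∈ Submodule.span ℝ (Set.range S.simple) := by
    intro α hα
    obtain ⟨c, rfl⟩ := S.pos_combo α hα
    exact Submodule.sum_mem _ fun i _ =>
      Submodule.smul_mem _ _ (Submodule.subset_span (Set.mem_range_self i))
  intro α hα
  rcases S.pos_or_neg α hα with h | h
  · exact key α h
  · simpa using Submodule.neg_mem _ (key _ h)

/-- The simple roots as a basis of the ambient space. -/
def basis : Module.Basis (Fin S.n) ℝ V := Module.Basis.mk S.simple_indep S.span_simple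

/-- The height as a real linear functional. -/
def ht : V →ₗ[ℝ] ℝ := ∑ i, S.basis.coord i

@[simp] theorem basis_apply (i : Fin S.n) : S.basis i = S.simple i := by
  simp [basis]

theorem coord_simple (i j : Fin S.n) : S.basis.coord i (S.simple j) = if j = i then 1 else 0 := by
  rw [← basis_apply, Module.Basis.coord_apply, Module.Basis.repr_self, Finsupp.single_apply]

theorem coord_sum (c : Fin S.n → ℝ) (i : Fin S.n) :
    S.basis.coord i (∑ j, c j • S.simple j) = c i := by
  simp [map_sum, coord_simple, -Module.Basis.coord_apply]

theorem sum_coord (x : V) : ∑ i, S.basis.coord i x • S.simple i = x := by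
  simpa using S.basis.sum_repr x

theorem ht_simple (i : Fin S.n) : S.ht (S.simple i) = 1 := by
  simp [ht, coord_simple, -Module.Basis.coord_apply]

theorem cast_htZ {x : V} (hx : S.inQ x) : (S.htZ x : ℝ) = S.ht x := by
  have h : ∃ c : Fin S.n → ℤ, x = ∑ i, (c i : ℝ) • S.simple i := hx
  rw [htZ, dif_pos h]
  conv_rhs => rw [h.choose_spec]
  simp [ht_simple]

theorem coord_nonneg {α : V} (hα : α ∈ S.Rpos) (i : Fin S.n) : 0 ≤ S.basis.coord i α := by
  obtain ⟨c, rfl⟩ := S.pos_combo α hα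
  rw [coord_sum]
  positivity

theorem inQ_of_pos {α : V} (hα : α ∈ S.Rpos) : S.inQ α := by
  obtain ⟨c, rfl⟩ := S.pos_combo α hα
  exact ⟨fun i => c i, by simp⟩

theorem inQ_of_mem {α : V} (hα : α ∈ S.R) : S.inQ α := by
  rcases S.pos_or_neg α hα with h | h
  · exact S.inQ_of_pos h
  · obtain ⟨c, hc⟩ := S.inQ_of_pos h
    exact ⟨fun i => -c i, by rw [← neg_neg α, hc]; simp⟩

theorem pos_of_coord_pos {α : V} (hα : α ∈ S.R) {i : Fin S.n} (h : 0 < S.basis.coord i α) :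
    α ∈ S.Rpos := by
  refine (S.pos_or_neg α hα).resolve_right fun h' => ?_
  have := S.coord_nonneg h' i
  rw [map_neg] at this
  linarith

theorem exists_coord_pos {α : V} (hα : α ∈ S.Rpos) {i : Fin S.n} (hi : α ≠ S.simple i) :
    ∃ j, j ≠ i ∧ 0 < S.basis.coord j α := by
  by_contra! h
  have h1 : S.basis.coord i α • S.simple i = α := by
    conv_rhs => rw [← S.sum_coord α]
    rw [Finset.sum_eq_single i]
    · intro j _ hj
      rw [le_antisymm (h j hj) (S.coord_nonneg hα j), zero_smul]
    · simp
  rcases S.reduced _ (S.simple_mem_R i) _ (h1.symm ▸ S.pos_sub hα) with h2 | h2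
  · rw [h2, one_smul] at h1
    exact hi h1.symm
  · have := S.coord_nonneg hα i
    linarith

theorem pos_sub_smul_simple {α : V} (hα : α ∈ S.Rpos) {i : Fin S.n} (hi : α ≠ S.simple i)
    {x : ℝ} (hx : α - x • S.simple i ∈ S.R) : α - x • S.simple i ∈ S.Rpos := by
  obtain ⟨j, hj, hpos⟩ := S.exists_coord_pos hα hi
  refine S.pos_of_coord_pos hx (i := j) ?_
  rw [map_sub, map_smul, coord_simple, if_neg hj.symm]
  simpa using hpos

theorem pos_sref_simple {α : V} (hα : α ∈ S.Rpos) {i : Fin S.n} (hi : α ≠ S.simple i) :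
    sref (S.simple i) α ∈ S.Rpos :=
  S.pos_sub_smul_simple hα hi (S.refl_mem _ (S.simple_mem_R i) _ (S.pos_sub hα))

theorem inner_simple_nonpos {i j : Fin S.n} (hij : i ≠ j) :
    ⟪S.simple i, S.simple j⟫ ≤ 0 := by
  have h := S.coord_nonneg (S.pos_sref_simple (S.simple_mem i) (i := j)
    fun h => hij (S.simple_indep.injective h)) j
  rw [sref, map_sub, map_smul, coord_simple, coord_simple, if_neg hij, if_pos rfl, smul_eq_mul,
    mul_one, zero_sub] at h
  have h0 := S.inner_self_pos (S.simple_mem_R j)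
  by_contra! h1
  have : 0 < 2 * ⟪S.simple i, S.simple j⟫ / ⟪S.simple j, S.simple j⟫ := by positivity
  linarith

theorem inner_eq_sum (x y : V) : ⟪x, y⟫ = ∑ i, S.basis.coord i y * ⟪x, S.simple i⟫ := by
  conv_lhs => rw [← S.sum_coord y]
  simp only [inner_sum, real_inner_smul_right]

theorem Dominant.inner_nonneg {S : RSD V} {μ α : V} (hμ : S.Dominant μ) (hα : α ∈ S.Rpos) :
    0 ≤ ⟪μ, α⟫ := by
  rw [S.inner_eq_sum]
  exact Finset.sum_nonneg fun i _ => mul_nonneg (S.coord_nonneg hα i) (hμ i)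

theorem Dominant.pos {S : RSD V} {μ : V} (hμ : S.Dominant μ) (h : μ ∈ S.R) : μ ∈ S.Rpos := by
  refine (S.pos_or_neg μ h).resolve_right fun h' => ?_
  have h1 := hμ.inner_nonneg h'
  rw [inner_neg_right] at h1
  linarith [S.inner_self_pos h]

theorem exists_inner_simple_pos {α : V} (hα : α ∈ S.Rpos) : ∃ i, 0 < ⟪α, S.simple i⟫ := by
  by_contra! h
  have h1 := S.inner_self_pos (S.pos_sub hα)
  rw [S.inner_eq_sum] at h1
  refine h1.not_ge (Finset.sum_nonpos fun i _ => ?_)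
  exact mul_nonpos_of_nonneg_of_nonpos (S.coord_nonneg hα i) (h i)

theorem ht_sref_simple (i : Fin S.n) (x : V) : S.ht (sref (S.simple i) x) =
    S.ht x - 2 * ⟪x, S.simple i⟫ / ⟪S.simple i, S.simple i⟫ := by
  rw [sref, map_sub, map_smul, ht_simple, smul_eq_mul, mul_one]

theorem ht_sref_simple_lt {i : Fin S.n} {x : V} (h : 0 < ⟪x, S.simple i⟫) :
    S.ht (sref (S.simple i) x) < S.ht x := by
  have := S.inner_self_pos (S.simple_mem_R i)
  rw [ht_sref_simple]
  have : 0 < 2 * ⟪x, S.simple i⟫ / ⟪S.simple i, S.simple i⟫ := by positivity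
  linarith

theorem lt_ht_sref_simple {i : Fin S.n} {x : V} (h : ⟪x, S.simple i⟫ < 0) :
    S.ht x < S.ht (sref (S.simple i) x) := by
  have h1 : 0 < ⟪sref (S.simple i) x, S.simple i⟫ := by rw [inner_sref_left]; linarith
  simpa [sref_sref] using S.ht_sref_simple_lt h1

/-- Induction on positive roots, starting from the simple roots and going up. -/
theorem pos_induction {P : V → Prop} (simple : ∀ i, P (S.simple i))
    (step : ∀ α ∈ S.Rpos, ∀ i, α ≠ S.simple i → 0 < ⟪α, S.simple i⟫ →
      P (sref (S.simple i) α) → P α) {α : V} (hα : α ∈ S.Rpos) : P α := by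
  by_contra hP
  obtain ⟨β, hβ, hmin⟩ := Finset.exists_min_image (S.Rpos.filter fun β => ¬ P β) S.ht
    ⟨α, Finset.mem_filter.2 ⟨hα, hP⟩⟩
  rw [Finset.mem_filter] at hβ
  obtain ⟨i, hi⟩ := S.exists_inner_simple_pos hβ.1
  have hne : β ≠ S.simple i := fun h => hβ.2 (h ▸ simple i)
  refine hβ.2 (step β hβ.1 i hne hi ?_)
  by_contra h
  exact (hmin _ (Finset.mem_filter.2 ⟨S.pos_sref_simple hβ.1 hne, h⟩)).not_gt
    (S.ht_sref_simple_lt hi)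

/-- Induction on positive roots, starting from the dominant roots and going down. -/
theorem pos_induction_down {P : V → Prop} (dominant : ∀ α ∈ S.R, S.Dominant α → P α)
    (step : ∀ α ∈ S.Rpos, ∀ i, α ≠ S.simple i → 0 < ⟪α, S.simple i⟫ →
      P α → P (sref (S.simple i) α)) {α : V} (hα : α ∈ S.Rpos) : P α := by
  by_contra hP
  obtain ⟨β, hβ, hmax⟩ := Finset.exists_max_image (S.Rpos.filter fun β => ¬ P β) S.ht
    ⟨α, Finset.mem_filter.2 ⟨hα, hP⟩⟩
  rw [Finset.mem_filter] at hβ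
  by_cases hd : S.Dominant β
  · exact hβ.2 (dominant β (S.pos_sub hβ.1) hd)
  obtain ⟨i, hi⟩ : ∃ i, ⟪β, S.simple i⟫ < 0 := by simpa [Dominant] using hd
  have h0 := S.inner_self_pos (S.simple_mem_R i)
  have hne : β ≠ S.simple i := by rintro rfl; linarith
  have hpos := S.pos_sref_simple hβ.1 hne
  have hi' : 0 < ⟪sref (S.simple i) β, S.simple i⟫ := by rw [inner_sref_left]; linarith
  have hP' : P (sref (S.simple i) β) := by
    by_contra h
    exact (hmax _ (Finset.mem_filter.2 ⟨hpos, h⟩)).not_gt (S.lt_ht_sref_simple hi)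
  have hne' : sref (S.simple i) β ≠ S.simple i := by
    intro h
    have h1 : β = -S.simple i := by
      rw [← sref_sref (S.simple i) β, h, sref_self (S.root_ne_zero _ (S.simple_mem_R i))]
    exact S.not_both _ (S.simple_mem i) (h1 ▸ hβ.1)
  exact hβ.2 (sref_sref (S.simple i) β ▸ step _ hpos i hne' hi' hP')

theorem exists_dominant {α : V} (hα : α ∈ S.R) :
    ∃ μ ∈ S.R, S.Dominant μ ∧ ⟪μ, μ⟫ = ⟪α, α⟫ := by
  obtain ⟨μ, hμ, hmax⟩ := Finset.exists_max_image (S.R.filter fun β => ⟪β, β⟫ = ⟪α, α⟫) S.ht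
    ⟨α, Finset.mem_filter.2 ⟨hα, rfl⟩⟩
  rw [Finset.mem_filter] at hμ
  refine ⟨μ, hμ.1, fun i => ?_, hμ.2⟩
  by_contra! h
  refine (hmax (sref (S.simple i) μ) (Finset.mem_filter.2
    ⟨S.refl_mem _ (S.simple_mem_R i) _ hμ.1, ?_⟩)).not_gt (S.lt_ht_sref_simple h)
  rw [inner_sref, hμ.2]

theorem Dominant.coord_pos {S : RSD V} {μ : V} (hμ : S.Dominant μ) (hR : μ ∈ S.R)
    (i : Fin S.n) : 0 < S.basis.coord i μ := by
  have hpos := hμ.pos hR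
  by_contra! hi
  have orth : ∀ k j, S.basis.coord k μ ≤ 0 → 0 < S.basis.coord j μ →
      ⟪S.simple k, S.simple j⟫ = 0 := by
    intro k j hk hj
    have hterm : ∀ l ∈ Finset.univ, S.basis.coord l μ * ⟪S.simple k, S.simple l⟫ ≤ 0 := by
      intro l _
      rcases eq_or_ne k l with rfl | hkl
      · rw [le_antisymm hk (S.coord_nonneg hpos k), zero_mul]
      · exact mul_nonpos_of_nonneg_of_nonpos (S.coord_nonneg hpos l) (S.inner_simple_nonpos hkl)
    have hsum : ∑ l, S.basis.coord l μ * ⟪S.simple k, S.simple l⟫ = 0 := by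
      refine le_antisymm (Finset.sum_nonpos hterm) ?_
      rw [← S.inner_eq_sum, real_inner_comm]
      exact hμ k
    have := (Finset.sum_eq_zero_iff_of_nonpos hterm).1 hsum j (Finset.mem_univ j)
    exact (mul_eq_zero.1 this).resolve_left hj.ne'
  -- the two coordinate subspaces cut out by the support of `μ`
  let A : V → Prop := fun x => ∀ k, S.basis.coord k μ ≤ 0 → S.basis.coord k x = 0
  let B : V → Prop := fun x => ∀ k, 0 < S.basis.coord k μ → S.basis.coord k x = 0
  have hAB : ∀ x y, A x → B y → ⟪x, y⟫ = 0 := by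
    intro x y hx hy
    rw [S.inner_eq_sum]
    refine Finset.sum_eq_zero fun k _ => ?_
    rcases le_or_gt (S.basis.coord k μ) 0 with hk | hk
    · rw [real_inner_comm, S.inner_eq_sum]
      refine mul_eq_zero_of_right _ (Finset.sum_eq_zero fun j _ => ?_)
      rcases le_or_gt (S.basis.coord j μ) 0 with hj | hj
      · rw [hx j hj, zero_mul]
      · rw [orth k j hk hj, mul_zero]
    · rw [hy k hk, zero_mul]
  have hA : ∀ j, 0 < S.basis.coord j μ → A (S.simple j) := by
    intro j hj k hk
    rw [coord_simple, if_neg]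
    rintro rfl
    linarith
  have hB : ∀ j, S.basis.coord j μ ≤ 0 → B (S.simple j) := by
    intro j hj k hk
    rw [coord_simple, if_neg]
    rintro rfl
    linarith
  have hall : ∀ α ∈ S.Rpos, A α ∨ B α := by
    intro α hα
    refine S.pos_induction (P := fun x => A x ∨ B x) (fun j => ?_) ?_ hα
    · rcases le_or_gt (S.basis.coord j μ) 0 with hj | hj
      · exact .inr (hB j hj)
      · exact .inl (hA j hj)
    · intro α _ j _ hj hP
      have hne : ⟪sref (S.simple j) α, S.simple j⟫ ≠ 0 := by
        rw [inner_sref_left]; linarith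
      have hα : ∀ k, S.basis.coord k α = S.basis.coord k (sref (S.simple j) α) +
          (2 * ⟪α, S.simple j⟫ / ⟪S.simple j, S.simple j⟫) * S.basis.coord k (S.simple j) := by
        intro k
        rw [sref, map_sub, map_smul, smul_eq_mul]
        ring
      rcases le_or_gt (S.basis.coord j μ) 0 with h | h
      · have hBα := hP.resolve_left fun h' => hne (hAB _ _ h' (hB j h))
        exact .inr fun k hk => by rw [hα, hBα k hk, hB j h k hk, mul_zero, add_zero]
      · have hAα := hP.resolve_right fun h' => hne (by
          rw [real_inner_comm]; exact hAB _ _ (hA j h) h')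
        exact .inl fun k hk => by rw [hα, hAα k hk, hA j h k hk, mul_zero, add_zero]
  have hall' : ∀ α ∈ S.R, A α ∨ B α := by
    intro α hα
    rcases S.pos_or_neg α hα with h | h
    · exact hall α h
    · refine (hall _ h).imp (fun h k hk => ?_) (fun h k hk => ?_)
      all_goals simpa using h k hk
  have hirr := S.irred {x | A x} fun α _ β hβ h1 h2 =>
    hAB α β h1 ((hall' β hβ).resolve_left h2)
  obtain ⟨j, -, hj⟩ : ∃ j, j ≠ i ∧ 0 < S.basis.coord j μ := by
    refine S.exists_coord_pos hpos ?_
    rintro rfl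
    rw [coord_simple, if_pos rfl] at hi
    linarith
  rcases hirr with h | h
  · have := h _ (S.simple_mem_R i) i hi
    rw [coord_simple, if_pos rfl] at this
    exact one_ne_zero this
  · exact h _ (S.simple_mem_R j) (hA j hj)

theorem Dominant.inner_pos {S : RSD V} {μ ν : V} (hμ : S.Dominant μ) (hμR : μ ∈ S.R)
    (hν : S.Dominant ν) (hνR : ν ∈ S.R) : 0 < ⟪μ, ν⟫ := by
  obtain ⟨i, hi⟩ := S.exists_inner_simple_pos (hμ.pos hμR)
  rw [S.inner_eq_sum]
  exact Finset.sum_pos' (fun j _ => mul_nonneg (S.coord_nonneg (hν.pos hνR) j) (hμ j))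
    ⟨i, Finset.mem_univ i, mul_pos (hν.coord_pos hνR i) hi⟩

theorem exists_int {α β : V} (hα : α ∈ S.R) (hβ : β ∈ S.R) :
    ∃ k : ℤ, 2 * ⟪β, α⟫ = k * ⟪α, α⟫ := by
  obtain ⟨k, hk⟩ := S.crystal α hα β hβ
  refine ⟨k, ?_⟩
  rw [inner_coroot, div_eq_iff (S.inner_self_pos hα).ne'] at hk
  exact hk

/-- A root pairs to one with the coroot of any distinct root that is at least as long and
makes an acute angle with it. -/
theorem two_mul_inner_eq {α β : V} (hα : α ∈ S.R) (hβ : β ∈ S.R) (hne : α ≠ β)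
    (hle : ⟪α, α⟫ ≤ ⟪β, β⟫) (hpos : 0 < ⟪α, β⟫) : 2 * ⟪α, β⟫ = ⟪β, β⟫ := by
  obtain ⟨k, hk⟩ := S.exists_int hβ hα
  have hβ0 := S.inner_self_pos hβ
  have h1 : 0 < k := by
    have : 0 < (k : ℝ) * ⟪β, β⟫ := by rw [← hk]; linarith
    exact_mod_cast pos_of_mul_pos_left this hβ0.le
  have h2 : k < 2 := by
    by_contra! h2
    have h2' : (2 : ℝ) ≤ k := by exact_mod_cast h2
    have h3 : 0 < ⟪α - β, α - β⟫ := real_inner_self_pos.2 (sub_ne_zero.2 hne)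
    rw [real_inner_sub_sub_self] at h3
    nlinarith
  obtain rfl : k = 1 := by omega
  simpa using hk

theorem sub_mem {α β : V} (hα : α ∈ S.R) (hβ : β ∈ S.R) (h : 2 * ⟪α, β⟫ = ⟪β, β⟫) :
    α - β ∈ S.R := by
  have := S.refl_mem β hβ α hα
  rwa [sref, h, div_self (S.inner_self_pos hβ).ne', one_smul] at this

/-- The squared length ratio of two roots of different length at an acute angle. -/
theorem ratio_of_lt {α β : V} (hα : α ∈ S.R) (hβ : β ∈ S.R)
    (hlt : ⟪α, α⟫ < ⟪β, β⟫) (hpos : 0 < ⟪α, β⟫) :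
    ⟪β, β⟫ = 2 * ⟪α, α⟫ ∨ ⟪β, β⟫ = 3 * ⟪α, α⟫ := by
  have hne : α ≠ β := by rintro rfl; exact lt_irrefl _ hlt
  have h1 := S.two_mul_inner_eq hα hβ hne hlt.le hpos
  obtain ⟨k, hk⟩ := S.exists_int hα hβ
  rw [real_inner_comm, h1] at hk
  have hα0 := S.inner_self_pos hα
  have hk1 : 1 < k := by
    by_contra! h
    have : (k : ℝ) ≤ 1 := by exact_mod_cast h
    nlinarith
  have hk4 : k < 4 := by
    by_contra! h
    have h4 : (4 : ℝ) ≤ k := by exact_mod_cast h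
    have h5 : 0 < ⟪β - (2 : ℝ) • α, β - (2 : ℝ) • α⟫ := by
      refine real_inner_self_pos.2 fun h0 => ?_
      rcases S.reduced α hα 2 (sub_eq_zero.1 h0 ▸ hβ) with h6 | h6 <;> norm_num at h6
    rw [real_inner_sub_sub_self, real_inner_smul_left, real_inner_smul_right,
      real_inner_smul_right, real_inner_comm α β] at h5
    nlinarith
  obtain rfl | rfl : k = 2 ∨ k = 3 := by omega
  · exact .inl (by exact_mod_cast hk)
  · exact .inr (by exact_mod_cast hk)

theorem Dominant.sub_pos {S : RSD V} {μ ν : V} (hμ : S.Dominant μ) (hμR : μ ∈ S.R)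
    (hν : S.Dominant ν) (hνR : ν ∈ S.R) (hne : μ ≠ ν) (hle : ⟪μ, μ⟫ ≤ ⟪ν, ν⟫) :
    ν - μ ∈ S.Rpos := by
  have h1 := S.two_mul_inner_eq hμR hνR hne hle (hμ.inner_pos hμR hν hνR)
  rw [← neg_sub]
  refine (S.pos_or_neg _ (S.sub_mem hμR hνR h1)).resolve_left fun h2 => ?_
  have h3 := hν.inner_nonneg h2
  rw [inner_sub_right, real_inner_comm] at h3
  linarith [S.inner_self_pos hνR]

theorem Dominant.eq_of_inner_self_eq {S : RSD V} {μ ν : V} (hμ : S.Dominant μ) (hμR : μ ∈ S.R)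
    (hν : S.Dominant ν) (hνR : ν ∈ S.R) (h : ⟪μ, μ⟫ = ⟪ν, ν⟫) : μ = ν := by
  by_contra hne
  refine S.not_both _ (hμ.sub_pos hμR hν hνR hne h.le) ?_
  rw [neg_sub]
  exact hν.sub_pos hνR hμ hμR (Ne.symm hne) h.ge

theorem inner_self_eq_of_lt {α β γ : V} (hα : α ∈ S.R) (hβ : β ∈ S.R) (hγ : γ ∈ S.R)
    (hα' : ⟪α, α⟫ < ⟪γ, γ⟫) (hβ' : ⟪β, β⟫ < ⟪γ, γ⟫) : ⟪α, α⟫ = ⟪β, β⟫ := by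
  have ratio : ∀ {α β : V}, α ∈ S.R → β ∈ S.R → ⟪α, α⟫ < ⟪β, β⟫ →
      ⟪β, β⟫ = 2 * ⟪α, α⟫ ∨ ⟪β, β⟫ = 3 * ⟪α, α⟫ := by
    intro α β hα hβ h
    obtain ⟨μ, hμR, hμ, hμα⟩ := S.exists_dominant hα
    obtain ⟨ν, hνR, hν, hνβ⟩ := S.exists_dominant hβ
    have := S.ratio_of_lt hμR hνR (by rwa [hμα, hνβ]) (hμ.inner_pos hμR hν hνR)
    rwa [hμα, hνβ] at this
  have h1 := ratio hα hγ hα'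
  have h2 := ratio hβ hγ hβ'
  have hα0 := S.inner_self_pos hα
  have hβ0 := S.inner_self_pos hβ
  rcases lt_trichotomy ⟪α, α⟫ ⟪β, β⟫ with h | h | h
  · have h3 := ratio hα hβ h
    rcases h1 with h1 | h1 <;> rcases h2 with h2 | h2 <;> rcases h3 with h3 | h3 <;> linarith
  · exact h
  · have h3 := ratio hβ hα h
    rcases h1 with h1 | h1 <;> rcases h2 with h2 | h2 <;> rcases h3 with h3 | h3 <;> linarith

theorem htZ_neg {α : V} (hα : α ∈ S.R) : S.htZ (-α) = -S.htZ α := by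
  have h1 := S.cast_htZ (S.inQ_of_mem (S.neg_mem hα))
  rw [map_neg, ← S.cast_htZ (S.inQ_of_mem hα)] at h1
  exact_mod_cast h1

theorem htZ_sub {α β : V} (hα : α ∈ S.R) (hβ : β ∈ S.R) (h : α - β ∈ S.R) :
    S.htZ (α - β) = S.htZ α - S.htZ β := by
  have h1 := S.cast_htZ (S.inQ_of_mem h)
  rw [map_sub, ← S.cast_htZ (S.inQ_of_mem hα), ← S.cast_htZ (S.inQ_of_mem hβ)] at h1
  exact_mod_cast h1

theorem htZ_simple (i : Fin S.n) : S.htZ (S.simple i) = 1 := by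
  have h1 := S.cast_htZ (S.inQ_of_mem (S.simple_mem_R i))
  rw [ht_simple] at h1
  exact_mod_cast h1

theorem htZ_sub_smul_simple {α : V} (hα : α ∈ S.R) {i : Fin S.n} {k : ℕ}
    (h : α - (k : ℝ) • S.simple i ∈ S.R) : S.htZ (α - (k : ℝ) • S.simple i) = S.htZ α - k := by
  have h1 := S.cast_htZ (S.inQ_of_mem h)
  rw [map_sub, map_smul, ht_simple, ← S.cast_htZ (S.inQ_of_mem hα), smul_eq_mul, mul_one] at h1
  exact_mod_cast h1

theorem htZ_pos {α : V} (hα : α ∈ S.Rpos) : 0 < S.htZ α := by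
  have h1 := S.cast_htZ (S.inQ_of_pos hα)
  have h2 : 0 < S.ht α := by
    obtain ⟨i, hi⟩ := S.exists_inner_simple_pos hα
    simp only [ht, LinearMap.sum_apply]
    refine Finset.sum_pos' (fun j _ => S.coord_nonneg hα j) ?_
    by_contra! h
    refine S.root_ne_zero α (S.pos_sub hα) ?_
    rw [← S.sum_coord α]
    exact Finset.sum_eq_zero fun j hj => by
      rw [le_antisymm (h j hj) (S.coord_nonneg hα j), zero_smul]
  rw [← h1] at h2
  exact_mod_cast h2

/-- A dominant root of maximal height is long. -/
theorem isLong_of_forall_htZ_le {θ : V}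
    (hθ : θ ∈ S.R ∧ S.Dominant θ ∧ ∀ α ∈ S.R, S.htZ α ≤ S.htZ θ) : S.IsLong θ := by
  obtain ⟨hR, hd, hmax⟩ := hθ
  refine ⟨hR, fun β hβ => ?_⟩
  by_contra! h
  obtain ⟨ν, hνR, hν, hνβ⟩ := S.exists_dominant hβ
  have hpos := hd.sub_pos hR hν hνR (by rintro rfl; linarith) (by linarith)
  have h1 := S.htZ_pos hpos
  rw [S.htZ_sub hνR hR (S.pos_sub hpos)] at h1
  linarith [hmax ν hνR]

@[simp] theorem wordMap_cons (i : Fin S.n) (l : List (Fin S.n)) :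
    S.wordMap (i :: l) = sref (S.simple i) ∘ S.wordMap l := rfl

theorem wordMap_mem (l : List (Fin S.n)) {α : V} (hα : α ∈ S.R) : S.wordMap l α ∈ S.R := by
  induction l with
  | nil => exact hα
  | cons i l ih => exact S.refl_mem _ (S.simple_mem_R i) _ ih

theorem inner_wordMap (l : List (Fin S.n)) (x y : V) :
    ⟪S.wordMap l x, S.wordMap l y⟫ = ⟪x, y⟫ := by
  induction l with
  | nil => rfl
  | cons i l ih => simp [inner_sref, ih]

theorem wordMap_sub_smul (l : List (Fin S.n)) (x y : V) (a : ℝ) :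
    S.wordMap l (x - a • y) = S.wordMap l x - a • S.wordMap l y := by
  induction l with
  | nil => rfl
  | cons i l ih =>
    simp only [wordMap_cons, Function.comp_apply, ih, sref, inner_sub_left, real_inner_smul_left]
    module

theorem wordMap_sref (l : List (Fin S.n)) (α x : V) :
    S.wordMap l (sref α x) = sref (S.wordMap l α) (S.wordMap l x) := by
  rw [sref, wordMap_sub_smul, sref, inner_wordMap, inner_wordMap]

theorem exchange (l : List (Fin S.n)) {α : V} (hα : α ∈ S.Rpos)
    (hneg : -S.wordMap l α ∈ S.Rpos) :
    ∃ l', l'.length < l.length ∧ S.wordMap l' = S.wordMap l ∘ sref α := by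
  induction l with
  | nil => exact absurd hneg (S.not_both α hα)
  | cons i l ih =>
    rcases S.pos_or_neg _ (S.wordMap_mem l (S.pos_sub hα)) with h | h
    · have heq : S.wordMap l α = S.simple i := by
        by_contra hne
        exact S.not_both _ (S.pos_sref_simple h hne) hneg
      refine ⟨l, by simp, ?_⟩
      ext x
      simp [wordMap_sref, heq, sref_sref]
    · obtain ⟨l', hl, h'⟩ := ih h
      exact ⟨i :: l', by simpa using hl, by rw [wordMap_cons, h', wordMap_cons]; rfl⟩

theorem len_le (l : List (Fin S.n)) : S.len (S.wordMap l) ≤ l.length :=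
  Nat.sInf_le ⟨l, rfl, rfl⟩

theorem exists_length_eq_len {w : V → V} (hw : S.IsWeyl w) :
    ∃ l : List (Fin S.n), l.length = S.len w ∧ w = S.wordMap l :=
  Nat.sInf_mem (s := {k | ∃ l : List (Fin S.n), l.length = k ∧ w = S.wordMap l})
    (let ⟨l, hl⟩ := hw; ⟨_, l, rfl, hl⟩)

/-- A minimal length representative does not invert any root orthogonal to its source. -/
theorem IsMinWord.inner_ne_zero {S : RSD V} {x y : V} {w : V → V} (hw : S.IsMinWord x y w)
    {α : V} (hα : α ∈ S.PiSet w) : ⟪x, α⟫ ≠ 0 := by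
  intro h0
  obtain ⟨hpos, hneg⟩ := Finset.mem_filter.1 hα
  obtain ⟨l, hl, rfl⟩ := S.exists_length_eq_len hw.1
  obtain ⟨l', hl', h'⟩ := S.exchange l hpos hneg
  have h1 := hw.2.2 (S.wordMap l') ⟨l', rfl⟩ (by
    rw [h', Function.comp_apply, sref_of_inner_eq_zero h0, hw.2.1])
  have := S.len_le l'
  omega

theorem sum_PiL_of_dominant {θ lam : V} {w : V → V} (hθ : S.IsLong θ) (hd : S.Dominant θ)
    (hw : S.IsMinWord θ lam w) :
    ∑ α ∈ S.PiL w, (⟪θ, coroot α⟫ - 1) = if -lam ∈ S.Rpos then 1 else 0 := by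
  have hpair : ∀ α ∈ S.PiL w, α ≠ θ → ⟪θ, coroot α⟫ - 1 = 0 := by
    intro α hα hne
    obtain ⟨h1, hlong⟩ := Finset.mem_filter.1 hα
    have hpos : 0 < ⟪θ, α⟫ := lt_of_le_of_ne
      (hd.inner_nonneg (Finset.mem_filter.1 h1).1) (hw.inner_ne_zero h1).symm
    have h2 := S.two_mul_inner_eq hθ.1 hlong.1 hne.symm (hlong.2 _ hθ.1) hpos
    rw [inner_coroot, h2, div_self (S.inner_self_pos hlong.1).ne', sub_self]
  have hmem : θ ∈ S.PiL w ↔ -lam ∈ S.Rpos := by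
    simp [PiL, PiSet, hθ, hd.pos hθ.1, hw.2.1]
  split_ifs with h
  · rw [Finset.sum_eq_single θ hpair (fun h' => absurd (hmem.2 h) h'), inner_coroot,
      mul_div_assoc, div_self (S.inner_self_pos hθ.1).ne']
    norm_num
  · exact Finset.sum_eq_zero fun α hα => hpair α hα (by rintro rfl; exact h (hmem.1 hα))

theorem tt_ne_zero : tt ≠ 0 := by
  rw [tt, map_ne_zero_iff _ (IsFractionRing.injective _ _)]
  exact MvPolynomial.X_ne_zero _

theorem qq_pow_mul_tt_pow_ne (a b m : ℕ) : qq ^ (a + 1) * tt ^ b ≠ tt ^ m := by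
  rw [qq, tt, ← map_pow, ← map_pow, ← map_pow, ← map_mul]
  intro h
  have h1 := congrArg (MvPolynomial.eval ![(0 : ℚ), 1])
    (IsFractionRing.injective (MvPolynomial (Fin 2) ℚ) FF h)
  simp at h1

theorem one_sub_tt_mul_sum (H : ℤ) {k : ℕ} (hk : 1 ≤ k) :
    (1 - tt) * ∑ j ∈ Finset.Ico 1 k, tt ^ (H - j) = tt ^ (H - k + 1) - tt ^ H := by
  induction k, hk using Nat.le_induction with
  | base => simp
  | succ k hk ih =>
    have h1 : tt ^ (H - k + 1) = tt * tt ^ (H - k) := by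
      rw [zpow_add_one₀ tt_ne_zero, mul_comm]
    have h2 : H - ((k + 1 : ℕ) : ℤ) + 1 = H - k := by push_cast; ring
    rw [Finset.sum_Ico_succ_top hk, mul_add, ih, h2, h1]
    ring

/-- The normalized deviation of `c β` from `t ^ ht β * X`. -/
def posDefect (c : V → FF) (X : FF) (β : V) : FF := c β * tt ^ (-S.htZ β) - X

/-- The normalized deviation of `c (-β)` from `t ^ (-ht β) * (t * X + 1 - t)`. -/
def negDefect (c : V → FF) (X : FF) (β : V) : FF :=
  c (-β) * tt ^ S.htZ β - (tt * X + 1 - tt)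

theorem eq_of_posDefect {c : V → FF} {X y : FF} {β : V} (h : S.posDefect c X β = y) :
    c β = tt ^ S.htZ β * (X + y) := by
  have := zpow_ne_zero (S.htZ β) tt_ne_zero
  rw [← h, posDefect, zpow_neg]
  field_simp
  ring

theorem eq_of_negDefect {c : V → FF} {X y : FF} {β : V} (h : S.negDefect c X β = y) :
    c (-β) = tt ^ (-S.htZ β) * (tt * X + 1 - tt + y) := by
  have := zpow_ne_zero (S.htZ β) tt_ne_zero
  rw [← h, negDefect, zpow_neg]
  field_simp
  ring

section Admissible

variable {S} {θ : V} {c : V → FF} {X : FF}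

theorem negDefect_simple (hc : Admissible S θ c) (i : Fin S.n) :
    S.negDefect c X (S.simple i) = tt * S.posDefect c X (S.simple i) := by
  have h0 := S.inner_self_pos (S.simple_mem_R i)
  have h := hc.2.1 (S.simple i) (S.inQ_of_mem (S.simple_mem_R i)) i 2 two_pos (by
    rw [inner_coroot, mul_div_assoc, div_self h0.ne']
    norm_num)
  rw [sref_self (S.root_ne_zero _ (S.simple_mem_R i))] at h
  have ht := tt_ne_zero
  simp only [Nat.Ico_succ_singleton, Finset.sum_singleton, Nat.cast_one, one_smul, sub_self,
    hc.1] at h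
  simp only [negDefect, posDefect, htZ_simple, zpow_neg, zpow_one]
  field_simp
  linear_combination h

/-- How the defects change along a root string whose interior has no defects. -/
theorem defect_step (hc : Admissible S θ c) {β : V} (hβ : β ∈ S.Rpos) {i : Fin S.n}
    {k : ℕ} (hk : 0 < k)
    (hpair : 2 * ⟪β, S.simple i⟫ = k * ⟪S.simple i, S.simple i⟫)
    (hstr : ∀ j ∈ Finset.Ico 1 k, β - (j : ℝ) • S.simple i ∈ S.R ∧
      S.posDefect c X (β - (j : ℝ) • S.simple i) = 0 ∧
      S.negDefect c X (β - (j : ℝ) • S.simple i) = 0) :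
    S.posDefect c X (sref (S.simple i) β) = tt ^ (k - 1) * S.posDefect c X β ∧
    S.negDefect c X β = tt ^ (k - 1) * S.negDefect c X (sref (S.simple i) β) := by
  have hR := S.pos_sub hβ
  have h0 := S.inner_self_pos (S.simple_mem_R i)
  have ht := tt_ne_zero
  have hs : sref (S.simple i) β = β - (k : ℝ) • S.simple i := by
    rw [sref, hpair, mul_div_assoc, div_self h0.ne', mul_one]
  have hsR := S.refl_mem _ (S.simple_mem_R i) _ hR
  have hsht : S.htZ (sref (S.simple i) β) = S.htZ β - k := by
    rw [hs] at hsR ⊢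
    exact S.htZ_sub_smul_simple hR hsR
  obtain ⟨m, rfl⟩ : ∃ m, k = m + 1 := ⟨k - 1, by omega⟩
  have hT := zpow_ne_zero (S.htZ β) ht
  constructor
  · have h := hc.2.1 β (S.inQ_of_pos hβ) i (m + 1) hk (by
      rw [inner_coroot, hpair, mul_div_assoc, div_self h0.ne', mul_one])
    rw [Finset.sum_congr rfl (g := fun j : ℕ => tt ^ (S.htZ β - j) * X), ← Finset.sum_mul,
      ← mul_assoc, one_sub_tt_mul_sum _ hk] at h
    · rw [posDefect, posDefect, hsht]
      push_cast at h ⊢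
      rw [show S.htZ β - ((m : ℤ) + 1) + 1 = S.htZ β - m by ring, zpow_sub₀ ht,
        zpow_natCast] at h
      rw [show -(S.htZ β - ((m : ℤ) + 1)) = -S.htZ β + m + 1 by ring, zpow_add_one₀ ht,
        zpow_add₀ ht, zpow_neg, zpow_natCast]
      field_simp at h ⊢
      linear_combination h
    · intro j hj
      obtain ⟨h1, h2, -⟩ := hstr j hj
      rw [S.eq_of_posDefect h2, S.htZ_sub_smul_simple hR h1, add_zero]
  · have h := hc.2.1 (-sref (S.simple i) β) (S.inQ_of_mem (S.neg_mem hsR)) i (m + 1) hk (by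
      rw [inner_coroot, inner_neg_left, inner_sref_left, neg_neg, hpair, mul_div_assoc,
        div_self h0.ne', mul_one])
    rw [sref_neg, sref_sref, Finset.sum_congr rfl (g := fun j : ℕ =>
        tt ^ (-S.htZ β + (m + 1 : ℕ) - j) * (tt * X + 1 - tt)), ← Finset.sum_mul,
      ← mul_assoc, one_sub_tt_mul_sum _ hk] at h
    · rw [negDefect, negDefect, hsht]
      push_cast at h ⊢
      rw [show -S.htZ β + ((m : ℤ) + 1) - ((m : ℤ) + 1) + 1 = -S.htZ β + 1 by ring,
        show -S.htZ β + ((m : ℤ) + 1) = -S.htZ β + m + 1 by ring, zpow_add_one₀ ht,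
        zpow_add_one₀ ht, zpow_add₀ ht, zpow_neg, zpow_natCast] at h
      rw [zpow_sub₀ ht, zpow_add_one₀ ht, zpow_natCast]
      field_simp at h ⊢
      linear_combination h
    · intro j hj
      have hj' := Finset.mem_Ico.1 hj
      obtain ⟨h1, -, h2⟩ := hstr (m + 1 - j) (Finset.mem_Ico.2 (by omega))
      have h3 : -sref (S.simple i) β - (j : ℝ) • S.simple i =
          -(β - ((m + 1 - j : ℕ) : ℝ) • S.simple i) := by
        rw [hs, Nat.cast_sub hj'.2.le]
        module
      rw [h3, S.eq_of_negDefect h2, S.htZ_sub_smul_simple hR h1, add_zero, Nat.cast_sub hj'.2.le]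
      congr 2
      ring

theorem defect_step_short (hc : Admissible S θ c) (hθ : S.IsLong θ) {β : V} (hβ : β ∈ S.Rpos)
    (hshort : ⟪β, β⟫ < ⟪θ, θ⟫) {i : Fin S.n} (hi : β ≠ S.simple i)
    (hpos : 0 < ⟪β, S.simple i⟫) :
    S.posDefect c X (sref (S.simple i) β) = S.posDefect c X β ∧
    S.negDefect c X β = S.negDefect c X (sref (S.simple i) β) := by
  have hle : ⟪β, β⟫ ≤ ⟪S.simple i, S.simple i⟫ := by
    by_contra! h
    exact h.ne (S.inner_self_eq_of_lt (S.simple_mem_R i) (S.pos_sub hβ) hθ.1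
      (h.trans hshort) hshort)
  have h := S.two_mul_inner_eq (S.pos_sub hβ) (S.simple_mem_R i) hi hle hpos
  simpa using defect_step hc (X := X) hβ one_pos (by simpa using h) (by simp)

theorem defect_eq_zero_of_short (hc : Admissible S θ c) (hθ : S.IsLong θ) (hd : S.Dominant θ)
    (hX : tt * qq * X * tt ^ S.htZ θ = tt * X + 1 - tt) {β : V} (hβ : β ∈ S.Rpos)
    (hshort : ⟪β, β⟫ < ⟪θ, θ⟫) : S.posDefect c X β = 0 ∧ S.negDefect c X β = 0 := by
  have hFE : ∀ {γ : V}, γ ∈ S.Rpos → ⟪γ, γ⟫ < ⟪θ, θ⟫ →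
      S.negDefect c X γ = tt * S.posDefect c X γ := by
    intro γ hγ
    refine S.pos_induction (P := fun x => ⟪x, x⟫ < ⟪θ, θ⟫ →
      S.negDefect c X x = tt * S.posDefect c X x) (fun i _ => negDefect_simple hc i) ?_ hγ
    intro α hα i hi hpos ih hlt
    obtain ⟨h1, h2⟩ := defect_step_short hc (X := X) hθ hα hlt hi hpos
    rw [h2, ih (by rwa [inner_sref]), h1]
  obtain ⟨μ, hμR, hμ, hμβ⟩ := S.exists_dominant (S.pos_sub hβ)
  have hconst : ∀ {γ : V}, γ ∈ S.Rpos → ⟪γ, γ⟫ < ⟪θ, θ⟫ →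
      S.posDefect c X γ = S.posDefect c X μ := by
    intro γ hγ
    refine S.pos_induction_down (P := fun x => ⟪x, x⟫ < ⟪θ, θ⟫ →
      S.posDefect c X x = S.posDefect c X μ) ?_ ?_ hγ
    · intro α hα hαd hlt
      rw [hαd.eq_of_inner_self_eq hα hμ hμR
        (S.inner_self_eq_of_lt hα hμR hθ.1 hlt (hμβ ▸ hshort))]
    · intro α hα i hi hpos ih hlt
      rw [inner_sref] at hlt
      rw [(defect_step_short hc hθ hα hlt hi hpos).1, ih hlt]
  have hμlt : ⟪μ, μ⟫ < ⟪θ, θ⟫ := hμβ ▸ hshort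
  have hne : μ ≠ θ := by rintro rfl; exact lt_irrefl _ hμlt
  have hpair := S.two_mul_inner_eq hμR hθ.1 hne hμlt.le (hμ.inner_pos hμR hd hθ.1)
  have h0 := S.inner_self_pos hθ.1
  have hγ := hμ.sub_pos hμR hd hθ.1 hne hμlt.le
  have hγlt : ⟪θ - μ, θ - μ⟫ < ⟪θ, θ⟫ := by
    rw [real_inner_sub_sub_self, real_inner_comm μ θ]
    linarith
  have hrel := hc.2.2 μ (S.inQ_of_mem hμR) 1 one_pos (by
    rw [inner_coroot, hpair, div_self h0.ne', Nat.cast_one])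
  rw [sref, hpair, div_self h0.ne', one_smul, ← neg_sub θ μ,
    S.eq_of_posDefect (c := c) (X := X) (β := μ) rfl,
    S.eq_of_negDefect (hFE hγ hγlt), hconst hγ hγlt, S.htZ_sub hθ.1 hμR (S.pos_sub hγ)] at hrel
  have hE : S.posDefect c X μ = 0 := by
    by_contra hE
    obtain ⟨n, hn⟩ := Int.eq_ofNat_of_zero_le (S.htZ_pos (hd.pos hθ.1)).le
    have ht := tt_ne_zero
    have hT := zpow_ne_zero (S.htZ μ) ht
    simp only [Finset.Ico_self, Finset.sum_empty, mul_zero, pow_one, neg_sub, zpow_sub₀ ht]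
      at hrel
    rw [← hX, hn, zpow_natCast] at hrel
    apply qq_pow_mul_tt_pow_ne 0 n 0
    have h1 : tt * tt ^ S.htZ μ * S.posDefect c X μ ≠ 0 := by positivity
    refine mul_left_cancel₀ h1 ?_
    field_simp at hrel
    linear_combination hrel
  exact ⟨by rw [hconst hβ hshort, hE], by rw [hFE hβ hshort, hconst hβ hshort, hE, mul_zero]⟩

theorem defect_step_long (hc : Admissible S θ c) (hθ : S.IsLong θ) (hd : S.Dominant θ)
    (hX : tt * qq * X * tt ^ S.htZ θ = tt * X + 1 - tt) {β : V} (hβ : β ∈ S.Rpos)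
    (hlong : ⟪β, β⟫ = ⟪θ, θ⟫) {i : Fin S.n} (hi : β ≠ S.simple i)
    (hpos : 0 < ⟪β, S.simple i⟫) :
    ∃ m : ℕ, S.posDefect c X (sref (S.simple i) β) = tt ^ m * S.posDefect c X β ∧
      S.negDefect c X β = tt ^ m * S.negDefect c X (sref (S.simple i) β) := by
  have hR := S.pos_sub hβ
  have hle : ⟪S.simple i, S.simple i⟫ ≤ ⟪β, β⟫ := hlong ▸ hθ.2 _ (S.simple_mem_R i)
  have h0 := S.inner_self_pos (S.simple_mem_R i)
  have hpair := S.two_mul_inner_eq (S.simple_mem_R i) hR hi.symm hle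
    (by rwa [real_inner_comm])
  rw [real_inner_comm] at hpair
  have hnorm : ∀ x : ℝ, ⟪β - x • S.simple i, β - x • S.simple i⟫ =
      ⟪β, β⟫ - x * ⟪β, β⟫ + x ^ 2 * ⟪S.simple i, S.simple i⟫ := by
    intro x
    rw [real_inner_sub_sub_self, real_inner_smul_left, real_inner_smul_right,
      real_inner_smul_right, ← hpair]
    ring
  have hzero : ∀ x : ℝ, β - x • S.simple i ∈ S.R →
      ⟪β - x • S.simple i, β - x • S.simple i⟫ < ⟪β, β⟫ → β - x • S.simple i ∈ S.R ∧
      S.posDefect c X (β - x • S.simple i) = 0 ∧ S.negDefect c X (β - x • S.simple i) = 0 :=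
    fun x hx hlt => ⟨hx, defect_eq_zero_of_short hc hθ hd hX
      (S.pos_sub_smul_simple hβ hi hx) (hlong ▸ hlt)⟩
  have h1 : β - (1 : ℝ) • S.simple i ∈ S.R := by
    have := S.neg_mem (S.sub_mem (S.simple_mem_R i) hR (by rw [real_inner_comm, hpair]))
    rwa [neg_sub, ← one_smul ℝ (S.simple i)] at this
  rcases hle.eq_or_lt with heq | hlt
  · exact ⟨0, defect_step hc hβ one_pos (by rw [hpair, heq]; simp) (by simp)⟩
  rcases S.ratio_of_lt (S.simple_mem_R i) hR hlt (by rwa [real_inner_comm]) with hr | hr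
  · refine ⟨1, defect_step hc (k := 2) hβ two_pos (by rw [hpair, hr]; simp) ?_⟩
    intro j hj
    obtain rfl : j = 1 := by rw [Finset.mem_Ico] at hj; omega
    rw [Nat.cast_one]
    exact hzero 1 h1 (by rw [hnorm]; linarith)
  · refine ⟨2, defect_step hc (k := 3) hβ three_pos (by rw [hpair, hr]; simp) ?_⟩
    intro j hj
    obtain rfl | rfl : j = 1 ∨ j = 2 := by rw [Finset.mem_Ico] at hj; omega
    · rw [Nat.cast_one]
      exact hzero 1 h1 (by rw [hnorm]; linarith)
    · rw [Nat.cast_ofNat]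
      refine hzero 2 ?_ (by rw [hnorm]; linarith)
      have h2 := S.refl_mem _ (S.simple_mem_R i) _ h1
      have h3 : 2 * ⟪β - (1 : ℝ) • S.simple i, S.simple i⟫ / ⟪S.simple i, S.simple i⟫ = 1 := by
        rw [one_smul, inner_sub_left, mul_sub, hpair, hr]
        field_simp
        norm_num
      rw [sref, h3] at h2
      convert h2 using 1
      module

theorem defect_eq_zero_of_long (hc : Admissible S θ c) (hθ : S.IsLong θ) (hd : S.Dominant θ)
    (hX : tt * qq * X * tt ^ S.htZ θ = tt * X + 1 - tt) {β : V} (hβ : β ∈ S.Rpos)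
    (hlong : ⟪β, β⟫ = ⟪θ, θ⟫) : S.posDefect c X β = 0 ∧ S.negDefect c X β = 0 := by
  have hθpos := hd.pos hθ.1
  obtain ⟨m, hm⟩ : ∃ m : ℕ, S.negDefect c X θ = tt ^ m * S.posDefect c X θ := by
    refine S.pos_induction (P := fun x => ⟪x, x⟫ = ⟪θ, θ⟫ →
      ∃ m : ℕ, S.negDefect c X x = tt ^ m * S.posDefect c X x)
      (fun i _ => ⟨1, by rw [pow_one, negDefect_simple hc]⟩) ?_ hθpos rfl
    intro α hα i hi hpos ih hlen
    obtain ⟨m, hm⟩ := ih (by rwa [inner_sref])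
    obtain ⟨k, h1, h2⟩ := defect_step_long hc hθ hd hX hα hlen hi hpos
    exact ⟨k + m + k, by rw [h2, hm, h1]; ring⟩
  have h0 := S.inner_self_pos hθ.1
  have hrel := hc.2.2 θ (S.inQ_of_mem hθ.1) 2 two_pos (by
    rw [inner_coroot, mul_div_assoc, div_self h0.ne']
    norm_num)
  rw [sref_self (S.root_ne_zero _ hθ.1), S.eq_of_posDefect (c := c) (X := X) rfl,
    S.eq_of_negDefect hm] at hrel
  simp only [Nat.Ico_succ_singleton, Finset.sum_singleton, Nat.cast_one, one_smul, sub_self,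
    hc.1] at hrel
  have hE : S.posDefect c X θ = 0 := by
    by_contra hE
    obtain ⟨n, hn⟩ := Int.eq_ofNat_of_zero_le (S.htZ_pos hθpos).le
    have ht := tt_ne_zero
    have hT := pow_ne_zero n ht
    rw [hn, zpow_natCast] at hX
    rw [← hX, hn, zpow_neg, zpow_natCast] at hrel
    apply qq_pow_mul_tt_pow_ne 1 (2 * n + 1) m
    refine mul_left_cancel₀ hE ?_
    field_simp at hrel
    linear_combination hrel - qq * tt ^ n * hX
  refine S.pos_induction_down (P := fun x => ⟪x, x⟫ = ⟪θ, θ⟫ →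
    S.posDefect c X x = 0 ∧ S.negDefect c X x = 0) ?_ ?_ hβ hlong
  · intro α hα hαd hlen
    rw [hαd.eq_of_inner_self_eq hα hd hθ.1 hlen, hm, hE, mul_zero]
    exact ⟨rfl, rfl⟩
  · intro α hα i hi hpos ih hlen
    rw [inner_sref] at hlen
    obtain ⟨h1, h2⟩ := ih hlen
    obtain ⟨k, h3, h4⟩ := defect_step_long hc hθ hd hX hα hlen hi hpos
    rw [h1, mul_zero] at h3
    rw [h2, eq_comm, mul_eq_zero] at h4
    exact ⟨h3, h4.resolve_left (pow_ne_zero k tt_ne_zero)⟩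

end Admissible

end RSD

/-- Suppose `R` is not simply laced. Let `(c_λ)` be an admissible family
and `X = (1 − t⁻¹)/(1 − q·t^{ht(θ)})`. Then for every long root `λ`,
`c_λ = t^{ht(λ)+D_λ(ℓ)}·X + (t^{ht(λ)} − t^{ht(λ)+D_λ(ℓ)})`, where
`D_λ(ℓ) = Σ_{α ∈ Π_ℓ(w_λ)} ((λ₊, α^∨) − 1)` (an integer, abstracted here as `Dl`). -/
theorem admissible_coefficient_of_long_root
    {V : Type*} [NormedAddCommGroup V] [InnerProductSpace ℝ V]
    (S : RSD V) (hTwo : ∃ α ∈ S.R, ∃ β ∈ S.R, ⟪α, α⟫ ≠ ⟪β, β⟫)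
    (θ : V) (hθ : θ ∈ S.R ∧ S.Dominant θ ∧ ∀ α ∈ S.R, S.htZ α ≤ S.htZ θ)
    (c : V → FF) (hc : Admissible S θ c)
    (lam : V) (hlong : S.IsLong lam)
    (lamp : V) (hdom : S.Dominant lamp) (horb : S.sameOrbit lam lamp)
    (w : V → V) (hw : S.IsMinWord lamp lam w)
    (Dl : ℤ) (hDl : (Dl : ℝ) = ∑ α ∈ S.PiL w, (⟪lamp, coroot α⟫ - 1)) :
    c lam
      = tt ^ (S.htZ lam + Dl) * ((1 - tt⁻¹) / (1 - qq * tt ^ (S.htZ θ)))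
        + (tt ^ (S.htZ lam) - tt ^ (S.htZ lam + Dl)) := by
  have hθlong := S.isLong_of_forall_htZ_le hθ
  obtain ⟨hθR, hd, -⟩ := hθ
  have hlen : ⟪lam, lam⟫ = ⟪θ, θ⟫ := le_antisymm (hθlong.2 _ hlong.1) (hlong.2 _ hθR)
  obtain rfl : lamp = θ := by
    obtain ⟨_, ⟨l, rfl⟩, hl⟩ := horb
    refine hdom.eq_of_inner_self_eq (hl ▸ S.wordMap_mem l hlong.1) hd hθR ?_
    rw [← hl, S.inner_wordMap, hlen]
  rw [S.sum_PiL_of_dominant hθlong hd hw] at hDl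
  have ht := RSD.tt_ne_zero
  generalize hX' : (1 - tt⁻¹) / (1 - qq * tt ^ S.htZ lamp) = X
  have hX : tt * qq * X * tt ^ S.htZ lamp = tt * X + 1 - tt := by
    obtain ⟨n, hn⟩ := Int.eq_ofNat_of_zero_le (S.htZ_pos (hd.pos hθR)).le
    have hne : 1 - qq * tt ^ n ≠ 0 := by
      have := RSD.qq_pow_mul_tt_pow_ne 0 n 0
      rw [zero_add, pow_one, pow_zero] at this
      exact sub_ne_zero.2 this.symm
    rw [hn, zpow_natCast] at hX' ⊢
    rw [div_eq_iff hne] at hX'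
    have h1 : tt * tt⁻¹ = 1 := mul_inv_cancel₀ ht
    linear_combination tt * hX' + h1
  rcases S.pos_or_neg lam hlong.1 with hpos | hneg
  · rw [if_neg (S.not_both lam hpos)] at hDl
    obtain rfl : Dl = 0 := by exact_mod_cast hDl
    rw [S.eq_of_posDefect (RSD.defect_eq_zero_of_long hc hθlong hd hX hpos hlen).1]
    simp
  · rw [if_pos hneg] at hDl
    obtain rfl : Dl = 1 := by exact_mod_cast hDl
    have h := S.eq_of_negDefect
      (RSD.defect_eq_zero_of_long hc hθlong hd hX hneg (by simpa using hlen)).2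
    rw [neg_neg, S.htZ_neg hlong.1, neg_neg] at h
    rw [h, zpow_add_one₀ ht]
    ring

end
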